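/- Let 0 < ℓ < 2, let c = 2/ℓ (so c > 1), let γ ∈ (0,1), K > 0, and let w* ∈ ℝ⁴. Suppose (w_n)_{n≥0} is a sequence in ℝ⁴ satisfying ‖w_{n+1} − L·w_n − w*‖ ≤ K·γ^(cⁿ) for all n ≥ 0. Then there exist real constants C_u, C_s, C_− and a constant K′ > 0 such that for all n ≥ 1, ‖w_n − (C_u·λ_uⁿ·E_u + C_s·λ_sⁿ·E_s + C_−·(−1)ⁿ·E_− + w_fix)‖ ≤ K′·γ^(c^(n−1)), where w_fix is the unique vector with L·w_fix + w* = w_fix. -/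

import Mathlib

/-- The matrix `L` of the linearized renormalization recursion. -/
noncomputable def Lmat (ℓ : ℝ) : Matrix (Fin 4) (Fin 4) ℝ :=
  !![1 + 1/ℓ, 1, 0, -1;
     -(1/ℓ), -1, 0, 1;
     1, 0, -1, 0;
     1 - 1/ℓ, 0, 0, 0]

/-- `λ_u = (1/ℓ + √(1/ℓ² + 4/ℓ))/2`. -/
noncomputable def lamU (ℓ : ℝ) : ℝ := (1/ℓ + Real.sqrt (1/ℓ^2 + 4/ℓ)) / 2

/-- `λ_s = (1/ℓ − √(1/ℓ² + 4/ℓ))/2`. -/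
noncomputable def lamS (ℓ : ℝ) : ℝ := (1/ℓ - Real.sqrt (1/ℓ^2 + 4/ℓ)) / 2

/-- The unstable eigenvector `E_u`. -/
noncomputable def Eu (ℓ : ℝ) : Fin 4 → ℝ :=
  ![1, (ℓ - 1 - lamU ℓ) / (ℓ * lamU ℓ * (1 + lamU ℓ)), 1 / (1 + lamU ℓ), (ℓ - 1) / (ℓ * lamU ℓ)]

/-- The stable eigenvector `E_s`. -/
noncomputable def Es (ℓ : ℝ) : Fin 4 → ℝ :=
  ![1, (ℓ - 1 - lamS ℓ) / (ℓ * lamS ℓ * (1 + lamS ℓ)), 1 / (1 + lamS ℓ), (ℓ - 1) / (ℓ * lamS ℓ)]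

/-- The eigenvector `E_−` for the eigenvalue `−1`. -/
noncomputable def Em : Fin 4 → ℝ := ![0, 0, -1, 0]

lemma aux_summable (γ c x : ℝ) (hγ0 : 0 < γ) (hγ1 : γ < 1) (hc : 1 < c) (hx : 0 < x) :
    Summable (fun m : ℕ => γ ^ (c ^ m) * x ^ m) := by
  have hpos : ∀ m : ℕ, 0 < γ ^ (c ^ m) * x ^ m := fun m => by positivity
  refine summable_of_ratio_test_tendsto_lt_one (l := 0) one_pos
    (Filter.Eventually.of_forall fun m => (hpos m).ne') ?_
  have h1 : (fun m : ℕ => ‖γ ^ (c ^ (m+1)) * x ^ (m+1)‖ / ‖γ ^ (c ^ m) * x ^ m‖)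
      = fun m : ℕ => γ ^ (c ^ m * (c - 1)) * x := by
    funext m
    rw [Real.norm_of_nonneg (hpos _).le, Real.norm_of_nonneg (hpos _).le,
      div_eq_iff (hpos m).ne']
    have : c ^ (m+1) = c ^ m * (c - 1) + c ^ m := by ring
    rw [this, Real.rpow_add hγ0]
    ring
  rw [h1]
  have h2 : Filter.Tendsto (fun m : ℕ => c ^ m * (c - 1)) Filter.atTop Filter.atTop :=
    (tendsto_pow_atTop_atTop_of_one_lt hc).atTop_mul_const (by linarith)
  have h3 := (tendsto_rpow_atTop_of_base_lt_one γ (by linarith) hγ1).comp h2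
  simpa using h3.mul_const x

lemma aux_scalar (γ c : ℝ) (hγ0 : 0 < γ) (hγ1 : γ < 1) (hc : 1 < c) (lam : ℝ) (hl : lam ≠ 0)
    (M : ℝ) (hM : 0 ≤ M) (a : ℕ → ℝ)
    (ha : ∀ n, |a (n+1) - lam * a n| ≤ M * γ ^ (c ^ n)) :
    ∃ C B : ℝ, 0 ≤ B ∧ ∀ n, |a n - C * lam ^ n| ≤ B * γ ^ (c ^ n) := by
  have hl' : 0 < |lam| := abs_pos.mpr hl
  have hs := aux_summable γ c (|lam|⁻¹) hγ0 hγ1 hc (by positivity)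
  set d : ℕ → ℝ := fun m => (M * |lam|⁻¹) * (γ ^ (c ^ m) * (|lam|⁻¹) ^ m) with hd
  have hds : Summable d := hs.mul_left _
  set b : ℕ → ℝ := fun n => a n / lam ^ n with hb
  have hdist : ∀ n, dist (b n) (b n.succ) ≤ d n := by
    intro n
    have h1 : b n - b n.succ = -((a (n+1) - lam * a n) / lam ^ (n+1)) := by
      simp only [hb, Nat.succ_eq_add_one]
      field_simp
      ring
    rw [Real.dist_eq, h1, abs_neg, abs_div, abs_pow, div_le_iff₀ (by positivity)]
    have h2 : d n * |lam| ^ (n+1) = M * γ ^ (c ^ n) := by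
      simp only [hd, inv_pow, pow_succ]
      field_simp
    rw [h2]
    exact ha n
  have hcau := cauchySeq_of_dist_le_of_summable d hdist hds
  obtain ⟨C, hC⟩ := cauchySeq_tendsto_of_complete hcau
  refine ⟨C, γ⁻¹ * ∑' m, d m, ?_, ?_⟩
  · have : 0 ≤ ∑' m, d m := tsum_nonneg fun m => by simp only [hd]; positivity
    positivity
  intro n
  have h1 := dist_le_tsum_of_dist_le_of_tendsto d hdist hds hC n
  have h2 : |a n - C * lam ^ n| = |lam| ^ n * dist (b n) C := by
    rw [Real.dist_eq, ← abs_pow, ← abs_mul]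
    congr 1
    simp only [hb]
    field_simp
  have hterm : ∀ m, |lam| ^ n * d (n + m) ≤ (γ⁻¹ * γ ^ (c ^ n)) * d m := by
    intro m
    have hn : 1 ≤ c ^ n := one_le_pow₀ hc.le
    have hm : 1 ≤ c ^ m := one_le_pow₀ hc.le
    have h3 : γ ^ (c ^ (n + m)) ≤ γ⁻¹ * γ ^ (c ^ n) * γ ^ (c ^ m) := by
      rw [← Real.rpow_neg_one, ← Real.rpow_add hγ0, ← Real.rpow_add hγ0]
      apply Real.rpow_le_rpow_of_exponent_ge hγ0 hγ1.le
      rw [pow_add]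
      nlinarith
    have h4 : |lam| ^ n * d (n + m) = (M * |lam|⁻¹ * (|lam|⁻¹) ^ m) * γ ^ (c ^ (n + m)) := by
      simp only [hd, inv_pow, pow_add]
      field_simp
    rw [h4]
    calc _ ≤ (M * |lam|⁻¹ * (|lam|⁻¹) ^ m) * (γ⁻¹ * γ ^ (c ^ n) * γ ^ (c ^ m)) := by
          gcongr
      _ = _ := by simp only [hd]; ring
  have hsn : Summable (fun m => d (n + m)) := by
    simpa [add_comm] using (summable_nat_add_iff n).mpr hds
  rw [h2]
  calc _ ≤ |lam| ^ n * ∑' m, d (n + m) := by gcongr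
    _ = ∑' m, |lam| ^ n * d (n + m) := tsum_mul_left.symm
    _ ≤ ∑' m, (γ⁻¹ * γ ^ (c ^ n)) * d m :=
        (hsn.mul_left _).tsum_le_tsum hterm (hds.mul_left _)
    _ = (γ⁻¹ * γ ^ (c ^ n)) * ∑' m, d m := tsum_mul_left
    _ = _ := by ring

lemma aux_dot (f r : Fin 4 → ℝ) : |f ⬝ᵥ r| ≤ (∑ i, |f i|) * ‖r‖ := by
  rw [dotProduct, Finset.sum_mul]
  refine (Finset.abs_sum_le_sum_abs _ _).trans (Finset.sum_le_sum fun i _ => ?_)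
  rw [abs_mul]
  have := norm_le_pi_norm r i
  rw [Real.norm_eq_abs] at this
  gcongr

lemma aux_vec (ℓ u s : ℝ) (h0 : 0 < ℓ) (hsum : ℓ * (u + s) = 1) (hprod : ℓ * (u * s) = -1) :
    (![1, (ℓ - 1 - u) / (ℓ * u * (1 + u)), 1 / (1 + u), (ℓ - 1) / (ℓ * u)] : Fin 4 → ℝ)
      = ![1, -ℓ * s - 1, 1 + s, -(ℓ - 1) * s] := by
  have hu : u ≠ 0 := by rintro rfl; simp at hprod
  have hus : (1 + u) * (1 + s) = 1 := by
    apply mul_left_cancel₀ h0.ne'; linear_combination hsum + hprod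
  have hu1 : 1 + u ≠ 0 := left_ne_zero_of_mul_eq_one hus
  have e2 : (ℓ - 1 - u) / (ℓ * u * (1 + u)) = -ℓ * s - 1 := by
    rw [div_eq_iff (by positivity)]
    linear_combination ℓ * (1 + u) * hprod + u * hsum - hprod
  have e3 : 1 / (1 + u) = 1 + s := by
    rw [div_eq_iff hu1]; linear_combination -hus
  have e4 : (ℓ - 1) / (ℓ * u) = -(ℓ - 1) * s := by
    rw [div_eq_iff (by positivity)]; linear_combination (ℓ - 1) * hprod
  rw [e2, e3, e4]

theorem stmt9 (ℓ : ℝ) (h0 : 0 < ℓ) (h2 : ℓ < 2) (γ K : ℝ)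
    (hγ : γ ∈ Set.Ioo (0:ℝ) 1) (hK : 0 < K)
    (wstar : Fin 4 → ℝ) (w : ℕ → Fin 4 → ℝ)
    (hw : ∀ n : ℕ, ‖w (n + 1) - (Lmat ℓ).mulVec (w n) - wstar‖ ≤ K * γ ^ ((2/ℓ) ^ n))
    (wfix : Fin 4 → ℝ) (hfix : (Lmat ℓ).mulVec wfix + wstar = wfix) :
    ∃ Cu Cs Cm K' : ℝ, 0 < K' ∧ ∀ n : ℕ, 1 ≤ n →
      ‖w n - ((Cu * lamU ℓ ^ n) • Eu ℓ + (Cs * lamS ℓ ^ n) • Es ℓ +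
        (Cm * (-1 : ℝ) ^ n) • Em + wfix)‖ ≤ K' * γ ^ ((2/ℓ) ^ (n - 1)) := by
  obtain ⟨hγ0, hγ1⟩ := hγ
  have hc : 1 < 2/ℓ := by rw [lt_div_iff₀ h0]; linarith
  -- the eigenvalues
  have hrad : 0 < 1/ℓ^2 + 4/ℓ := by positivity
  have hsq := Real.sq_sqrt hrad.le
  have hsum : ℓ * (lamU ℓ + lamS ℓ) = 1 := by
    unfold lamU lamS; field_simp; ring
  have hprod : ℓ * (lamU ℓ * lamS ℓ) = -1 := by
    have : lamU ℓ * lamS ℓ = ((1/ℓ)^2 - Real.sqrt (1/ℓ^2 + 4/ℓ) ^ 2) / 4 := by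
      unfold lamU lamS; ring
    rw [this, hsq]; field_simp; ring
  have hD : 0 < lamU ℓ - lamS ℓ := by
    have := Real.sqrt_pos.mpr hrad
    unfold lamU lamS; linarith
  have hEu : Eu ℓ = ![1, -ℓ * lamS ℓ - 1, 1 + lamS ℓ, -(ℓ - 1) * lamS ℓ] := by
    exact aux_vec ℓ _ _ h0 hsum hprod
  have hEs : Es ℓ = ![1, -ℓ * lamU ℓ - 1, 1 + lamU ℓ, -(ℓ - 1) * lamU ℓ] := by
    exact aux_vec ℓ _ _ h0 (by linarith) (by linarith)
  generalize Eu ℓ = eu at *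
  generalize Es ℓ = es at *
  generalize lamU ℓ = u at *
  generalize lamS ℓ = s at *
  have hu : u ≠ 0 := by rintro rfl; simp at hprod
  have hs : s ≠ 0 := by rintro rfl; simp at hprod
  set c := 2/ℓ with hcdef
  -- general functional
  have key : ∀ (f : Fin 4 → ℝ) (lam : ℝ), (∀ v, f ⬝ᵥ (Lmat ℓ).mulVec v = lam * (f ⬝ᵥ v)) →
      ∃ M, 0 ≤ M ∧ ∀ n, |f ⬝ᵥ (w (n+1) - wfix) - lam * (f ⬝ᵥ (w n - wfix))| ≤ M * γ ^ (c ^ n) := by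
    intro f lam hf
    refine ⟨(∑ i, |f i|) * K, by positivity, fun n => ?_⟩
    have h1 : f ⬝ᵥ (w (n+1) - wfix) - lam * (f ⬝ᵥ (w n - wfix))
        = f ⬝ᵥ (w (n + 1) - (Lmat ℓ).mulVec (w n) - wstar) := by
      rw [← hf, ← dotProduct_sub]
      congr 1
      rw [Matrix.mulVec_sub]
      nth_rewrite 1 [← hfix]
      abel
    rw [h1, mul_assoc]
    refine (aux_dot _ _).trans ?_
    gcongr
    exact hw n
  have hL : ∀ v : Fin 4 → ℝ, (Lmat ℓ).mulVec v = ![(1 + 1/ℓ) * v 0 + v 1 - v 3,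
      -(1/ℓ) * v 0 - v 1 + v 3, v 0 - v 2, (1 - 1/ℓ) * v 0] := by
    intro v
    ext i
    fin_cases i <;> simp [Lmat, Matrix.mulVec, dotProduct, Fin.sum_univ_four] <;> ring
  have hli : ℓ * (1/ℓ) = 1 := by field_simp
  generalize 1/ℓ = k at *
  have hsum' : u + s = k := by
    apply mul_left_cancel₀ h0.ne'; linarith
  have hprod' : u * s = -k := by
    apply mul_left_cancel₀ h0.ne'; linarith
  obtain ⟨Mu, hMu, hu'⟩ := key ![(1+u)/(u-s), 1/(u-s), 0, -1/(u-s)] u (by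
    intro v
    rw [hL]
    simp [dotProduct, Fin.sum_univ_four]
    field_simp
    subst hsum'
    linear_combination (v 0) * hprod')
  obtain ⟨Ms, hMs, hs'⟩ := key ![-(1+s)/(u-s), -1/(u-s), 0, 1/(u-s)] s (by
    intro v
    rw [hL]
    simp [dotProduct, Fin.sum_univ_four]
    field_simp
    subst hsum'
    linear_combination -(v 0) * hprod')
  obtain ⟨Mm, hMm, hm'⟩ := key ![0, -1, -1, 1] (-1) (by
    intro v
    rw [hL]
    simp [dotProduct, Fin.sum_univ_four]
    ring)
  obtain ⟨Me, hMe, he'⟩ := key ![-(ℓ-1), -(ℓ-1), 0, ℓ] 0 (by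
    intro v
    rw [hL]
    simp [dotProduct, Fin.sum_univ_four]
    linear_combination (-v 0) * hli)
  obtain ⟨Cu, Bu, hBu, hCu⟩ := aux_scalar γ c hγ0 hγ1 hc u hu Mu hMu
    (fun n => ![(1+u)/(u-s), 1/(u-s), 0, -1/(u-s)] ⬝ᵥ (w n - wfix)) hu'
  obtain ⟨Cs, Bs, hBs, hCs⟩ := aux_scalar γ c hγ0 hγ1 hc s hs Ms hMs
    (fun n => ![-(1+s)/(u-s), -1/(u-s), 0, 1/(u-s)] ⬝ᵥ (w n - wfix)) hs'
  obtain ⟨Cm, Bm, hBm, hCm⟩ := aux_scalar γ c hγ0 hγ1 hc (-1) (by norm_num) Mm hMm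
    (fun n => ![0, -1, -1, 1] ⬝ᵥ (w n - wfix)) hm'
  refine ⟨Cu, Cs, Cm, Bu * ‖eu‖ + Bs * ‖es‖ + Bm * ‖Em‖ + Me * ‖(![0,1,0,1] : Fin 4 → ℝ)‖ + 1,
    by positivity, ?_⟩
  intro n hn
  obtain ⟨n, rfl⟩ : ∃ m, n = m + 1 := ⟨n - 1, by omega⟩
  rw [Nat.add_sub_cancel]
  have hmono : γ ^ (c ^ (n+1)) ≤ γ ^ (c ^ n) :=
    Real.rpow_le_rpow_of_exponent_ge hγ0 hγ1.le (pow_le_pow_right₀ hc.le (Nat.le_succ n))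
  have a1 := (hCu (n+1)).trans (mul_le_mul_of_nonneg_left hmono hBu)
  have a2 := (hCs (n+1)).trans (mul_le_mul_of_nonneg_left hmono hBs)
  have a3 := (hCm (n+1)).trans (mul_le_mul_of_nonneg_left hmono hBm)
  have a4 := he' n
  beta_reduce at a1 a2 a3
  rw [zero_mul, sub_zero] at a4
  have hdec : ∀ v : Fin 4 → ℝ, v = (![(1+u)/(u-s), 1/(u-s), 0, -1/(u-s)] ⬝ᵥ v) • eu
      + (![-(1+s)/(u-s), -1/(u-s), 0, 1/(u-s)] ⬝ᵥ v) • es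
      + (![0, -1, -1, 1] ⬝ᵥ v) • Em + (![-(ℓ-1), -(ℓ-1), 0, ℓ] ⬝ᵥ v) • ![0,1,0,1] := by
    intro v
    rw [hEu, hEs]
    ext i
    fin_cases i <;> simp [dotProduct, Fin.sum_univ_four, Em] <;> field_simp <;> ring
  have hd := hdec (w (n+1) - wfix)
  generalize ![(1+u)/(u-s), 1/(u-s), 0, -1/(u-s)] ⬝ᵥ (w (n+1) - wfix) = A at *
  generalize ![-(1+s)/(u-s), -1/(u-s), 0, 1/(u-s)] ⬝ᵥ (w (n+1) - wfix) = B at *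
  generalize ![0, -1, -1, 1] ⬝ᵥ (w (n+1) - wfix) = E at *
  generalize ![-(ℓ-1), -(ℓ-1), 0, ℓ] ⬝ᵥ (w (n+1) - wfix) = F at *
  have h3 : w (n+1) - ((Cu * u ^ (n+1)) • eu + (Cs * s ^ (n+1)) • es +
        (Cm * (-1 : ℝ) ^ (n+1)) • Em + wfix) = (A - Cu * u ^ (n+1)) • eu
        + (B - Cs * s ^ (n+1)) • es + (E - Cm * (-1 : ℝ) ^ (n+1)) • Em + F • ![0,1,0,1] := by
    rw [← sub_sub_sub_cancel_right _ _ wfix, hd]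
    module
  rw [h3]
  have hg : 0 < γ ^ (c ^ n) := by positivity
  calc _ ≤ |A - Cu * u ^ (n+1)| * ‖eu‖ + |B - Cs * s ^ (n+1)| * ‖es‖
        + |E - Cm * (-1 : ℝ) ^ (n+1)| * ‖Em‖ + |F| * ‖(![0,1,0,1] : Fin 4 → ℝ)‖ := by
        simp only [← Real.norm_eq_abs, ← norm_smul]
        exact norm_add₄_le
    _ ≤ (Bu * γ ^ (c ^ n)) * ‖eu‖ + (Bs * γ ^ (c ^ n)) * ‖es‖ + (Bm * γ ^ (c ^ n)) * ‖Em‖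
        + (Me * γ ^ (c ^ n)) * ‖(![0,1,0,1] : Fin 4 → ℝ)‖ := by gcongr
    _ ≤ _ := by nlinarith
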